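/- Let W and V be B-DMCs with the same finite output alphabet Y, and assume V(y|x) > 0 for all y ∈ Y and x ∈ {0,1}. Then the polar transform preserves the mismatched mutual information: I(W⁻, V⁻) + I(W⁺, V⁺) = 2·I(W,V). -/

import Mathlib

open Finset
open scoped Classical

/-- A channel `W : {0,1} → Y` is a B-DMC if each row is a probability mass function. -/
def IsBDMC {Y : Type*} [Fintype Y] (W : Bool → Y → ℝ) : Prop :=
  (∀ x y, 0 ≤ W x y) ∧ (∀ x, ∑ y : Y, W x y = 1)

/-- The output distribution of a channel under uniform inputs. -/
noncomputable def qOut {Y : Type*} (W : Bool → Y → ℝ) (y : Y) : ℝ :=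
  (W false y + W true y) / 2

/-- The Δ parameter of a channel (with the convention 0/0 = 0, automatic in Lean). -/
noncomputable def Δch {Y : Type*} (V : Bool → Y → ℝ) (y : Y) : ℝ :=
  (V false y - V true y) / (V false y + V true y)

/-- The likelihood ratio of a channel. -/
noncomputable def LR {Y : Type*} (V : Bool → Y → ℝ) (y : Y) : ℝ :=
  V true y / V false y

/-- The mismatched mutual information `I(W, V)` (base-2 logarithm). -/
noncomputable def Imm {Y : Type*} [Fintype Y] (W V : Bool → Y → ℝ) : ℝ :=
  (1/2) * ∑ x : Bool, ∑ y : Y, W x y * Real.logb 2 (V x y / qOut V y)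

/-- The mismatched ML decoding error probability `P_{e,ML}(W, V)`. -/
noncomputable def PeML {Y : Type*} [Fintype Y] (W V : Bool → Y → ℝ) : ℝ :=
  (1/2) * ∑ y ∈ univ.filter (fun y => 1 < LR V y), W false y
  + (1/4) * ∑ y ∈ univ.filter (fun y => LR V y = 1), W false y
  + (1/2) * ∑ y ∈ univ.filter (fun y => LR V y < 1), W true y
  + (1/4) * ∑ y ∈ univ.filter (fun y => LR V y = 1), W true y

/-- The mismatched parameter `D(W, V)`. -/
noncomputable def Dpar {Y : Type*} [Fintype Y] (W V : Bool → Y → ℝ) : ℝ :=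
  ∑ y : Y, qOut W y * Real.sqrt |Δch V y|

/-- The mismatched variational distance `T(W, V)`. -/
noncomputable def Tpar {Y : Type*} [Fintype Y] (W V : Bool → Y → ℝ) : ℝ :=
  ∑ y : Y, qOut W y * |Δch V y|

/-- The mismatched parameter `T_k(W, V)`. -/
noncomputable def Tkpar {Y : Type*} [Fintype Y] (k : ℕ) (W V : Bool → Y → ℝ) : ℝ :=
  ∑ y : Y, qOut W y * |Δch V y| ^ k

/-- The mismatched Bhattacharyya parameter `Z(W, V)`. -/
noncomputable def Zpar {Y : Type*} [Fintype Y] (W V : Bool → Y → ℝ) : ℝ :=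
  (1/2) * ∑ y : Y, W false y * Real.sqrt (LR V y)
  + (1/2) * ∑ y : Y, W true y * Real.sqrt (1 / LR V y)

/-- The minus polar transform `W⁻(y₁y₂ | u₁) = (1/2) ∑_{u₂} W(y₁|u₁⊕u₂) W(y₂|u₂)`. -/
noncomputable def polarMinus {Y : Type*} (W : Bool → Y → ℝ) : Bool → Y × Y → ℝ :=
  fun u₁ p => (1/2) * ∑ u₂ : Bool, W (Bool.xor u₁ u₂) p.1 * W u₂ p.2

/-- The plus polar transform `W⁺(y₁y₂u₁ | u₂) = (1/2) W(y₁|u₁⊕u₂) W(y₂|u₂)`,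
with output `(y₁, y₂, u₁)`. -/
noncomputable def polarPlus {Y : Type*} (W : Bool → Y → ℝ) : Bool → Y × Y × Bool → ℝ :=
  fun u₂ p => (1/2) * W (Bool.xor p.2.2 u₂) p.1 * W u₂ p.2.1

theorem qOut_pos {Y : Type*} {V : Bool → Y → ℝ} (hVpos : ∀ x y, 0 < V x y) (y : Y) :
    0 < qOut V y :=
  half_pos (add_pos (hVpos false y) (hVpos true y))

theorem polarMinus_pos {Y : Type*} {V : Bool → Y → ℝ} (hVpos : ∀ x y, 0 < V x y)
    (u : Bool) (p : Y × Y) : 0 < polarMinus V u p :=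
  mul_pos (by norm_num)
    (sum_pos (fun _ _ => mul_pos (hVpos _ _) (hVpos _ _)) univ_nonempty)

theorem polarPlus_pos {Y : Type*} {V : Bool → Y → ℝ} (hVpos : ∀ x y, 0 < V x y)
    (u : Bool) (p : Y × Y × Bool) : 0 < polarPlus V u p :=
  mul_pos (mul_pos (by norm_num) (hVpos _ _)) (hVpos _ _)

theorem qOut_polarMinus {Y : Type*} (V : Bool → Y → ℝ) (p : Y × Y) :
    qOut (polarMinus V) p = qOut V p.1 * qOut V p.2 := by
  simp only [qOut, polarMinus, Fintype.sum_bool, Bool.xor_true, Bool.xor_false, Bool.not_true,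
    Bool.not_false]
  ring

theorem qOut_polarPlus {Y : Type*} (V : Bool → Y → ℝ) (y₁ y₂ : Y) (u : Bool) :
    qOut (polarPlus V) (y₁, y₂, u) = polarMinus V u (y₁, y₂) / 2 := by
  simp only [qOut, polarPlus, polarMinus, Fintype.sum_bool]
  ring

/-- Chain rule for the information densities of the polar transforms. -/
theorem logb_polarMinus_add_logb_polarPlus {Y : Type*} {V : Bool → Y → ℝ}
    (hVpos : ∀ x y, 0 < V x y) (u₁ u₂ : Bool) (y₁ y₂ : Y) :
    Real.logb 2 (polarMinus V u₁ (y₁, y₂) / qOut (polarMinus V) (y₁, y₂))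
      + Real.logb 2 (polarPlus V u₂ (y₁, y₂, u₁) / qOut (polarPlus V) (y₁, y₂, u₁))
      = Real.logb 2 (V (Bool.xor u₁ u₂) y₁ / qOut V y₁) + Real.logb 2 (V u₂ y₂ / qOut V y₂) := by
  have hq := fun y => (qOut_pos hVpos y).ne'
  have hV := fun x y => (hVpos x y).ne'
  have hm := (polarMinus_pos hVpos u₁ (y₁, y₂)).ne'
  have hp := (polarPlus_pos hVpos u₂ (y₁, y₂, u₁)).ne'
  rw [qOut_polarMinus, qOut_polarPlus,
    ← Real.logb_mul (div_ne_zero hm (mul_ne_zero (hq _) (hq _)))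
      (div_ne_zero hp (div_ne_zero hm two_ne_zero)),
    ← Real.logb_mul (div_ne_zero (hV _ _) (hq _)) (div_ne_zero (hV _ _) (hq _))]
  congr 1
  have h₁ := hq y₁
  have h₂ := hq y₂
  simp only [polarPlus]
  field_simp

/-- The two polar transforms, weighted by the joint law of two independent channel uses. -/
theorem Imm_polarMinus_add_Imm_polarPlus_eq_sum {Y : Type*} [Fintype Y] (W : Bool → Y → ℝ)
    {V : Bool → Y → ℝ} (hVpos : ∀ x y, 0 < V x y) :
    Imm (polarMinus W) (polarMinus V) + Imm (polarPlus W) (polarPlus V)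
      = (1/4) * ∑ y₁ : Y, ∑ y₂ : Y, ∑ x₁ : Bool, ∑ x₂ : Bool, W x₁ y₁ * W x₂ y₂ *
          (Real.logb 2 (V x₁ y₁ / qOut V y₁) + Real.logb 2 (V x₂ y₂ / qOut V y₂)) := by
  simp only [Imm, Fintype.sum_prod_type, Fintype.sum_bool, ← sum_add_distrib, mul_sum]
  refine sum_congr rfl fun y₁ _ => sum_congr rfl fun y₂ _ => ?_
  have h := fun u₁ u₂ => logb_polarMinus_add_logb_polarPlus hVpos u₁ u₂ y₁ y₂
  have hff := h false false
  have hft := h false true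
  have htf := h true false
  have htt := h true true
  simp only [Bool.xor_true, Bool.xor_false, Bool.not_true, Bool.not_false] at hff hft htf htt
  simp only [polarMinus.eq_def W, polarPlus.eq_def W, Fintype.sum_bool, Bool.xor_true,
    Bool.xor_false, Bool.not_true, Bool.not_false]
  linear_combination (1/4) * (W false y₁ * W false y₂ * hff + W true y₁ * W true y₂ * hft
    + W true y₁ * W false y₂ * htf + W false y₁ * W true y₂ * htt)

/-- `I(W⁻, V⁻) + I(W⁺, V⁺) = 2 I(W, V)`. -/
theorem Imm_polarMinus_add_Imm_polarPlus {Y : Type*} [Fintype Y] (W V : Bool → Y → ℝ)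
    (hW : IsBDMC W) (hV : IsBDMC V) (hVpos : ∀ x y, 0 < V x y) :
    Imm (polarMinus W) (polarMinus V) + Imm (polarPlus W) (polarPlus V)
      = 2 * Imm W V := by
  rw [Imm_polarMinus_add_Imm_polarPlus_eq_sum W hVpos]
  set i : Bool → Y → ℝ := fun x y => Real.logb 2 (V x y / qOut V y)
  have hsum : ∑ y₁ : Y, ∑ y₂ : Y, ∑ x₁ : Bool, ∑ x₂ : Bool,
        W x₁ y₁ * W x₂ y₂ * (i x₁ y₁ + i x₂ y₂)
      = (∑ y, ∑ x, W x y * i x y) * (∑ y, ∑ x, W x y)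
        + (∑ y, ∑ x, W x y) * (∑ y, ∑ x, W x y * i x y) := by
    simp only [sum_mul_sum, ← sum_add_distrib]
    refine sum_congr rfl fun y₁ _ => sum_congr rfl fun y₂ _ => sum_congr rfl fun x₁ _ =>
      sum_congr rfl fun x₂ _ => ?_
    ring
  have hmass : ∑ y, ∑ x, W x y = 2 := by
    rw [sum_comm, Fintype.sum_bool, hW.2, hW.2]
    norm_num
  have hImm : Imm W V = (1/2) * ∑ y, ∑ x, W x y * i x y := by
    rw [sum_comm, Imm]
  rw [hImm, hsum, hmass]
  ring
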